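/- Let X ⊆ A^ℤ be an aperiodic Toeplitz subshift. The following are equivalent: (1) (X,S) is conjugate to (X,S^{−1}); (2) for every Toeplitz sequence x ∈ X there is a positive integer p dividing the scale of X such that for every q > p with p | q and q dividing the scale of X, x has nice symmetries with respect to (p,q); (3) the set of x ∈ X for which there is a positive integer p dividing the scale of X such that for every q > p with p | q and q dividing the scale of X, x has nice symmetries with respect to (p,q), is nonmeager in X; (4) there exist a Toeplitz sequence x ∈ X and a positive integer p dividing the scale of X such that for every q > p with p | q and q dividing the scale of X, x has nice symmetries with respect to (p,q). -/

import Mathlib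

namespace ToeplitzFR

open Set

variable {A B C : Type*}

/-- The shift map `S` on `ℤ → A`: `S(x)(i) = x(i+1)`. -/
def shift (x : ℤ → A) : ℤ → A := fun i => x (i + 1)

/-- The inverse shift map `S⁻¹`. -/
def shiftInv (x : ℤ → A) : ℤ → A := fun i => x (i - 1)

/-- The shift by `k`: `S^k`. -/
def shiftBy (k : ℤ) (x : ℤ → A) : ℤ → A := fun i => x (i + k)

/-- The finite word `x[i, i+n)`. -/
def factorAt (x : ℤ → A) (i : ℤ) (n : ℕ) : List A :=
  (List.range n).map fun j => x (i + j)

/-- `x` is a periodic point of the shift. -/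
def IsPeriodicPoint (x : ℤ → A) : Prop := ∃ p : ℕ, 0 < p ∧ ∀ i : ℤ, x (i + p) = x i

def IsAperiodicPoint (x : ℤ → A) : Prop := ¬ IsPeriodicPoint x

/-- `Per_p(x)`. -/
def PerSet (x : ℤ → A) (p : ℕ) : Set ℤ := {i : ℤ | ∀ k : ℤ, x (i + k * p) = x i}

/-- `Per(x) = ⋃_{p>1} Per_p(x)`. -/
def PerAll (x : ℤ → A) : Set ℤ := {i : ℤ | ∃ p : ℕ, 1 < p ∧ i ∈ PerSet x p}

/-- `x` is a Toeplitz sequence. -/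
def IsToeplitz (x : ℤ → A) : Prop := ∀ i : ℤ, ∃ p : ℕ, 1 < p ∧ i ∈ PerSet x p

/-- The shift orbit of `x`. -/
def orbit (x : ℤ → A) : Set (ℤ → A) := {y | ∃ k : ℤ, y = shiftBy k x}

/-- `X` is the Toeplitz subshift generated by the Toeplitz sequence `x`. -/
def ToeplitzGenerates [TopologicalSpace A] (x : ℤ → A) (X : Set (ℤ → A)) : Prop :=
  IsToeplitz x ∧ X = closure (orbit x)

/-- `X` is a Toeplitz subshift. -/
def IsToeplitzSubshift [TopologicalSpace A] (X : Set (ℤ → A)) : Prop :=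
  ∃ x : ℤ → A, ToeplitzGenerates x X

/-- The `p`-skeleton of `x`, with `none` as the blank symbol. -/
noncomputable def Skel (x : ℤ → A) (p : ℕ) : ℤ → Option A :=
  fun i => @ite _ (i ∈ PerSet x p) (Classical.dec _) (some (x i)) none

/-- `p` is an essential period of `x`. -/
def IsEssentialPeriod (x : ℤ → A) (p : ℕ) : Prop :=
  1 < p ∧ ∀ q : ℕ, 0 < q → q < p → ∃ i : ℤ, Skel x p (i + q) ≠ Skel x p i

/-- `(P n)` is a period structure for `x`. -/
def IsPeriodStructure (x : ℤ → A) (P : ℕ → ℕ) : Prop :=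
  StrictMono P ∧ (∀ n, IsEssentialPeriod x (P n)) ∧ (∀ n, P n ∣ P (n+1)) ∧
    ∀ i : ℤ, ∃ n, i ∈ PerSet x (P n)

/-- `q` divides the scale of the Toeplitz subshift `X`. -/
def DividesScale [TopologicalSpace A] (X : Set (ℤ → A)) (q : ℕ) : Prop :=
  ∃ (x : ℤ → A) (P : ℕ → ℕ),
    ToeplitzGenerates x X ∧ IsPeriodStructure x P ∧ ∃ n, q ∣ P n

/-! ### Directive sequences and S-adic subshifts -/

/-- All morphisms in the directive sequence are non-erasing. -/
def NonErasing {A : ℕ → Type*} (τ : ∀ n, A (n+1) → List (A n)) : Prop :=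
  ∀ n a, τ n a ≠ []

/-- The directive sequence has constant length. -/
def ConstantLength {A : ℕ → Type*} (τ : ∀ n, A (n+1) → List (A n)) : Prop :=
  ∀ n, ∀ a b : A (n+1), (τ n a).length = (τ n b).length

/-- The directive sequence is proper. -/
def ProperSeq {A : ℕ → Type*} (τ : ∀ n, A (n+1) → List (A n)) : Prop :=
  ∀ n, ∃ b c : A n, ∀ a : A (n+1), (τ n a).head? = some b ∧ (τ n a).getLast? = some c

/-- `sadicWordAux τ n k a = τ_{[n, n+k)}(a)`. -/
def sadicWordAux {A : ℕ → Type*} (τ : ∀ n, A (n+1) → List (A n)) (n : ℕ) :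
    ∀ k : ℕ, A (n + k) → List (A n)
  | 0, a => [a]
  | (k+1), a => (τ (n+k) a).flatMap (sadicWordAux τ n k)

/-- `word0 τ k a = τ_{[0, k)}(a)` for `a ∈ A k`. -/
def word0 {A : ℕ → Type*} (τ : ∀ n, A (n+1) → List (A n)) :
    ∀ k : ℕ, A k → List (A 0)
  | 0, a => [a]
  | (k+1), a => (τ k a).flatMap (word0 τ k)

/-- The directive sequence is primitive. -/
def PrimitiveSeq {A : ℕ → Type*} (τ : ∀ n, A (n+1) → List (A n)) : Prop :=
  ∀ n, ∃ k : ℕ, 0 < k ∧ ∀ (a : A (n+k)) (b : A n), b ∈ sadicWordAux τ n k a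

/-- The `n`-th level `X_τ^{(n)}` of the S-adic system generated by `τ`. -/
def XLevel {A : ℕ → Type*} (τ : ∀ n, A (n+1) → List (A n)) (n : ℕ) :
    Set (ℤ → A n) :=
  {y | ∀ (i : ℤ) (m : ℕ), ∃ k : ℕ, 0 < k ∧ ∃ a : A (n+k),
      (factorAt y i m).IsInfix (sadicWordAux τ n k a)}

/-- The alphabet rank (`liminf_n |A_n|`) is at most `K`. -/
def AlphabetRankLE (A : ℕ → Type*) [∀ n, Fintype (A n)] (K : ℕ) : Prop :=
  ∀ N : ℕ, ∃ n, N ≤ n ∧ Fintype.card (A n) ≤ K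

/-! ### Recognizability -/

/-- `z` is the bi-infinite concatenation `⋯σ(y(-1)).σ(y(0))σ(y(1))⋯`,
with `σ(y(0))` starting at coordinate `0`. -/
def IsConcat (σ : B → List C) (y : ℤ → B) (z : ℤ → C) : Prop :=
  ∃ c : ℤ → ℤ, c 0 = 0 ∧ (∀ j : ℤ, c (j + 1) = c j + (σ (y j)).length) ∧
    ∀ (j : ℤ) (m : Fin (σ (y j)).length), z (c j + (m : ℕ)) = (σ (y j)).get m

/-- `(y, k)` is a centered `σ`-representation of `x` in `Y`. -/
def IsCenteredRep (σ : B → List C) (Y : Set (ℤ → B)) (x : ℤ → C)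
    (y : ℤ → B) (k : ℕ) : Prop :=
  y ∈ Y ∧ k < (σ (y 0)).length ∧ IsConcat σ y (fun m => x (m - k))

/-- The morphism `σ` is recognizable in `Y`. -/
def RecognizableIn (σ : B → List C) (Y : Set (ℤ → B)) : Prop :=
  ∀ (x : ℤ → C) (y y' : ℤ → B) (k k' : ℕ),
    IsCenteredRep σ Y x y k → IsCenteredRep σ Y x y' k' → y = y' ∧ k = k'

/-- The directive sequence `τ` is recognizable. -/
def RecognizableSeq {A : ℕ → Type*} (τ : ∀ n, A (n+1) → List (A n)) : Prop :=
  ∀ n, RecognizableIn (τ n) (XLevel τ (n+1))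

/-! ### Conjugacy -/

/-- `(X, TX)` and `(Y, TY)` are conjugate via a homeomorphism. -/
def ConjugateBy [TopologicalSpace A] [TopologicalSpace B]
    (X : Set (ℤ → A)) (Y : Set (ℤ → B))
    (TX : (ℤ → A) → (ℤ → A)) (TY : (ℤ → B) → (ℤ → B)) : Prop :=
  ∃ φ : ↥X ≃ₜ ↥Y, ∀ (x : ℤ → A) (hx : x ∈ X) (hx' : TX x ∈ X),
    (φ ⟨TX x, hx'⟩).1 = TY (φ ⟨x, hx⟩).1

/-- `(X, S)` and `(Y, S)` are conjugate subshifts. -/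
def Conjugate [TopologicalSpace A] [TopologicalSpace B]
    (X : Set (ℤ → A)) (Y : Set (ℤ → B)) : Prop :=
  ConjugateBy X Y shift shift

/-- `X` is a strong Toeplitz subshift of rank `K`: it is conjugate to the S-adic subshift
of a constant-length, primitive, proper and recognizable directive sequence of
alphabet rank at most `K`. -/
def IsStrongToeplitzOfRank [TopologicalSpace A] (X : Set (ℤ → A)) (K : ℕ) : Prop :=
  ∃ (B : ℕ → Type) (iB : ∀ n, Fintype (B n)) (σ : ∀ n, B (n+1) → List (B n)),
    NonErasing σ ∧ ConstantLength σ ∧ PrimitiveSeq σ ∧ ProperSeq σ ∧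
    RecognizableSeq σ ∧ @AlphabetRankLE B iB K ∧
    @Conjugate A (B 0) _ ⊥ X (XLevel σ 0)

/-- `X` is conjugate to the S-adic subshift of a primitive, proper and recognizable
directive sequence of alphabet rank at most `K`. -/
def HasFiniteRankSAdicRep [TopologicalSpace A] (X : Set (ℤ → A)) (K : ℕ) : Prop :=
  ∃ (B : ℕ → Type) (iB : ∀ n, Fintype (B n)) (σ : ∀ n, B (n+1) → List (B n)),
    NonErasing σ ∧ PrimitiveSeq σ ∧ ProperSeq σ ∧
    RecognizableSeq σ ∧ @AlphabetRankLE B iB K ∧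
    @Conjugate A (B 0) _ ⊥ X (XLevel σ 0)

/-! ### Cuts, languages, built-from -/

/-- The set of words `{x[t+kp, t+(k+1)p) : k ∈ ℤ}`. -/
def cutWords (x : ℤ → A) (p t : ℕ) : Set (List A) :=
  {w | ∃ k : ℤ, w = factorAt x ((t : ℤ) + k * p) p}

/-- `(p, t)` is a strong rank-2 cut of `x`. -/
def StrongRank2Cut (x : ℤ → A) (p t : ℕ) : Prop :=
  t < p ∧ ∃ u v : List A, u ≠ v ∧ cutWords x p t = {u, v}

/-- The language `L_n(X)`. -/
def Lang (n : ℕ) (X : Set (ℤ → A)) : Set (List A) :=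
  {w | ∃ x ∈ X, ∃ i : ℤ, w = factorAt x i n}

/-- The maximal common prefix of `u` and `v` has length greater than `m`. -/
def CommonPrefixLongerThan (u v : List A) (m : ℕ) : Prop :=
  m + 1 ≤ u.length ∧ m + 1 ≤ v.length ∧ u.take (m+1) = v.take (m+1)

/-- The maximal common suffix of `u` and `v` has length greater than `m`. -/
def CommonSuffixLongerThan (u v : List A) (m : ℕ) : Prop :=
  CommonPrefixLongerThan u.reverse v.reverse m

/-- `b = (β₀, (α₁, …, α_k), β₁)` is a building of the word `w` from `W`:
`w = β₀α₁⋯α_kβ₁`, all `αᵢ ∈ W`, `β₀` is a proper suffix of an element of `W`,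
and `β₁` is a proper prefix of an element of `W`. -/
def IsBuilding (W : Set (List A)) (w : List A)
    (b : List A × List (List A) × List A) : Prop :=
  w = b.1 ++ b.2.1.flatten ++ b.2.2 ∧ (∀ α ∈ b.2.1, α ∈ W) ∧
  (∃ u ∈ W, b.1 <:+ u ∧ b.1 ≠ u) ∧ (∃ u ∈ W, b.2.2 <+: u ∧ b.2.2 ≠ u)

/-- `w` is uniquely built from `W`. -/
def UniquelyBuiltFrom (W : Set (List A)) (w : List A) : Prop :=
  ∃! b : List A × List (List A) × List A, IsBuilding W w b

/-- `X` together with one of its points satisfies the strong rank-2 cut property. -/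
def GoodCuts [TopologicalSpace A] (X : Set (ℤ → A)) (x : ℤ → A) : Prop :=
  ∀ p : ℕ, 0 < p → DividesScale X p → ∀ m : ℕ,
    ∃ q t : ℕ, StrongRank2Cut x q t ∧ p ∣ q ∧ DividesScale X q ∧
      ∃ u v : List A, u ≠ v ∧ cutWords x q t = {u, v} ∧
        CommonPrefixLongerThan u v m ∧ CommonSuffixLongerThan u v m

/-! ### Euclidean pairs and buildings of bi-infinite sequences -/

/-- `{u, v}` is a Euclidean pair. -/
def EuclideanPair (u v : List A) : Prop :=
  ∃ (w : List A) (k l : ℕ),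
    u = (List.replicate k w).flatten ∧ v = (List.replicate l w).flatten

/-- `α` is the distinguished prefix of `u` and `v`. -/
def IsDistinguishedPrefix (u v α : List A) : Prop :=
  α.length < u.length + v.length ∧
  ∀ x y : List A,
    (∃ l : List (List A), (∀ w ∈ l, w = u ∨ w = v) ∧ x = u ++ l.flatten) →
    (∃ l : List (List A), (∀ w ∈ l, w = u ∨ w = v) ∧ y = v ++ l.flatten) →
    α.length + 1 ≤ x.length → α.length + 1 ≤ y.length →
    α <+: x ∧ α <+: y ∧ x[α.length]? ≠ y[α.length]?

/-- `β` is the distinguished suffix of `u` and `v`. -/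
def IsDistinguishedSuffix (u v β : List A) : Prop :=
  IsDistinguishedPrefix u.reverse v.reverse β.reverse

/-- `(c, f)` is a building of the bi-infinite sequence `x` from `W`:
block `j` starts at position `c j` and carries the word `f j ∈ W`. -/
def IsBuildingSeq (W : Set (List A)) (x : ℤ → A) (c : ℤ → ℤ) (f : ℤ → List A) : Prop :=
  (∀ j : ℤ, f j ∈ W) ∧ (∀ j : ℤ, c (j + 1) = c j + (f j).length) ∧
  ∀ (j : ℤ) (m : Fin (f j).length), x (c j + (m : ℕ)) = (f j).get m

/-- The subshift `X_{u,v}` of all sequences built from `{u, v}`. -/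
def Xuv (u v : List A) : Set (ℤ → A) :=
  {x | ∃ (c : ℤ → ℤ) (f : ℤ → List A), IsBuildingSeq {u, v} x c f}

/-! ### Block-code conjugacies -/

/-- A conjugacy `φ : X → Y` admitting block width `2n+1`. -/
structure BlockConjugacy (A : Type*) (X Y : Set (ℤ → A)) (n : ℕ) where
  toFun : (ℤ → A) → (ℤ → A)
  invFun : (ℤ → A) → (ℤ → A)
  maps_to : ∀ x ∈ X, toFun x ∈ Y
  maps_from : ∀ y ∈ Y, invFun y ∈ X
  left_inv : ∀ x ∈ X, invFun (toFun x) = x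
  right_inv : ∀ y ∈ Y, toFun (invFun y) = y
  shift_comm : ∀ x ∈ X, toFun (shift x) = shift (toFun x)
  code : List A → A
  code_inv : List A → A
  code_spec : ∀ x ∈ X, ∀ i : ℤ, toFun x i = code (factorAt x (i - n) (2*n+1))
  code_inv_spec : ∀ y ∈ Y, ∀ i : ℤ, invFun y i = code_inv (factorAt y (i - n) (2*n+1))

/-! ### Parts, permutation action, χ -/

/-- `W` is a member of `Parts(X, p)`: a class of the common-`p`-skeleton relation. -/
def SkelClass (X : Set (ℤ → A)) (p : ℕ) (W : Set (ℤ → A)) : Prop :=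
  ∃ y ∈ X, W = {z ∈ X | Skel z p = Skel y p}

/-- The map `ψ̂` induced by a permutation `ψ` of `A^p`. -/
def permHat (p : ℕ) (ψ : Equiv.Perm (Fin p → A)) (x : ℤ → A) : ℤ → A :=
  fun i =>
    if h : (i.emod p).toNat < p then
      ψ (fun m : Fin p => x (i - i.emod p + (m : ℕ))) ⟨(i.emod p).toNat, h⟩
    else x i

/-- The relation `E_p` on compact subsets of `A^ℤ`. -/
def EpRel (p : ℕ) (K L : Set (ℤ → A)) : Prop :=
  ∃ ψ : Equiv.Perm (Fin p → A), L = permHat p ψ '' K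

/-- `W ∈ Parts_*(X, p)`. -/
def SkelClassStar (X : Set (ℤ → A)) (p : ℕ) (W : Set (ℤ → A)) : Prop :=
  SkelClass X p W ∧ ∀ y ∈ W, Skel y p (-1) = none ∧ Skel y p 0 ≠ none

/-- `length(W) = L` for `W ∈ Parts_*(X, p)`. -/
def HasLength (p : ℕ) (W : Set (ℤ → A)) (L : ℕ) : Prop :=
  ∀ y ∈ W, (∀ i : ℕ, i < L → Skel y p (i : ℤ) ≠ none) ∧ Skel y p (L : ℤ) = none

/-- `Z ∈ χ(X, p)`. -/
def ChiMem (X : Set (ℤ → A)) (p : ℕ) (Z : Set (ℤ → A)) : Prop :=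
  ∃ (W : Set (ℤ → A)) (L : ℕ), SkelClassStar X p W ∧ HasLength p W L ∧
    (∀ (W' : Set (ℤ → A)) (L' : ℕ),
      SkelClassStar X p W' → HasLength p W' L' → L' ≤ L) ∧
    Z = shiftBy ((L / 2 : ℕ) : ℤ) '' W

/-- `χ(X, p) E_p^fin χ(Y, p)`. -/
def ChiEpFin (X Y : Set (ℤ → A)) (p : ℕ) : Prop :=
  (∀ K, ChiMem X p K → ∃ L, ChiMem Y p L ∧ EpRel p K L) ∧
  (∀ L, ChiMem Y p L → ∃ K, ChiMem X p K ∧ EpRel p K L)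

/-! ### Single holes and fillings -/

/-- The Toeplitz sequence `x` has single holes with respect to the period structure `P`. -/
def SingleHoles (x : ℤ → A) (P : ℕ → ℕ) : Prop :=
  IsPeriodStructure x P ∧
  ∀ n, ∃! i : ℤ, 0 ≤ i ∧ i < (P n : ℤ) ∧ i ∉ PerSet x (P n)

/-- The Toeplitz subshift `X` has single holes. -/
def HasSingleHoles [TopologicalSpace A] (X : Set (ℤ → A)) : Prop :=
  ∃ (x : ℤ → A) (P : ℕ → ℕ), ToeplitzGenerates x X ∧ SingleHoles x P

/-- `w` is the `(n, m)`-filling of `x` (for periods `pn < pm`). -/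
def IsFilling (x : ℤ → A) (pn pm : ℕ) (w : List A) : Prop :=
  w.length = pm / pn - 1 ∧
  ∀ h : ℤ, 0 ≤ h → h < (pm : ℤ) → h ∉ PerSet x pm →
    ∀ (j : ℕ) (hj : j < w.length), w.get ⟨j, hj⟩ = x (h + (j+1) * pn)

/-- `u` is a `θ`-palindrome. -/
def ThetaPalindrome (θ : Equiv.Perm A) (u : List A) : Prop :=
  u.map (fun a => θ a) = u.reverse

/-! ### Nice symmetries -/

/-- `x` has nice symmetries with respect to `(p, q)`. -/
def NiceSymmetries (x : ℤ → A) (p q : ℕ) : Prop :=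
  ∃ m : ℤ, 1 < m ∧ m ≤ (q : ℤ) + 1 ∧
    (∀ k : ℕ, k < q / p →
      (Set.Ico ((k * p : ℕ) : ℤ) (((k+1) * p : ℕ) : ℤ) ⊆ PerSet x q ↔
       Set.Ico (m - ((k+1) * p : ℕ)) (m - (k * p : ℕ)) ⊆ PerSet x q)) ∧
    (∀ k k' : ℕ, k < q / p → k' < q / p →
      Set.Ico ((k * p : ℕ) : ℤ) (((k+1) * p : ℕ) : ℤ) ⊆ PerSet x q →
      Set.Ico ((k' * p : ℕ) : ℤ) (((k'+1) * p : ℕ) : ℤ) ⊆ PerSet x q →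
      (factorAt x ((k * p : ℕ) : ℤ) p = factorAt x ((k' * p : ℕ) : ℤ) p ↔
       factorAt x (m - ((k+1) * p : ℕ)) p = factorAt x (m - ((k'+1) * p : ℕ)) p))

/-- For some `p` dividing the scale of `X`, `x` has nice symmetries with respect to
`(p, q)` for all `q > p` with `p ∣ q` dividing the scale of `X`. -/
def NiceSymAll [TopologicalSpace A] (X : Set (ℤ → A)) (x : ℤ → A) : Prop :=
  ∃ p : ℕ, 0 < p ∧ DividesScale X p ∧
    ∀ q : ℕ, p < q → p ∣ q → DividesScale X q → NiceSymmetries x p q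

/-- A pair `(x, x')` is a centered left asymptotic pair. -/
def CenteredLeftAsymptoticPair (x x' : ℤ → A) : Prop :=
  (∀ i : ℤ, i < 0 → x i = x' i) ∧ x 0 ≠ x' 0

/-! ### Automorphism groups -/

/-- `e` is an automorphism of the subshift `(X, S)`. -/
def IsShiftAutomorphism [TopologicalSpace A] (X : Set (ℤ → A)) (e : ↥X ≃ₜ ↥X) : Prop :=
  ∀ (x : ℤ → A) (hx : x ∈ X) (hx' : shift x ∈ X),
    (e ⟨shift x, hx'⟩).1 = shift (e ⟨x, hx⟩).1

/-- The automorphism group of `(X, S)` is isomorphic, as a group, to `ℤ × ℤ/nℤ`. -/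
def AutGroupIsoZxZmod [TopologicalSpace A] (X : Set (ℤ → A)) (n : ℕ) : Prop :=
  ∃ Φ : {e : ↥X ≃ₜ ↥X // IsShiftAutomorphism X e} → ℤ × ZMod n,
    Function.Bijective Φ ∧
    ∀ e f g : {e : ↥X ≃ₜ ↥X // IsShiftAutomorphism X e},
      (∀ z : ↥X, g.1 z = e.1 (f.1 z)) → Φ g = Φ e + Φ f

/-! ### The Polish space of subshifts over `ℤ` -/

/-- A point of the space `𝐒` of all (compact, nonempty, shift-invariant) subshifts
over finite alphabets contained in `ℤ`. -/
structure SubshiftSpace : Type where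
  carrier : Set (ℤ → ℤ)
  nonempty : carrier.Nonempty
  compact : IsCompact carrier
  invariant : shift '' carrier = carrier

/-- The topology on `𝐒` induced by the languages `(L_n(X))_{n}`, with each
family of `n`-languages discrete; this coincides with the metric
`d(X,Y) = 2^{-min{n : L_n(X) ≠ L_n(Y)}}`. -/
instance : TopologicalSpace SubshiftSpace :=
  TopologicalSpace.induced
    (fun X : SubshiftSpace => (fun n => Lang n X.carrier : ℕ → Set (List ℤ)))
    (@Pi.topologicalSpace ℕ (fun _ => Set (List ℤ)) (fun _ => ⊥))

/-- The subset `𝐌 ⊆ 𝐒` of infinite minimal subshifts. -/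
def MinimalSet : Set SubshiftSpace :=
  {X | X.carrier.Infinite ∧ ∀ x ∈ X.carrier, X.carrier ⊆ closure (orbit x)}


/-! ### Auxiliary lemmas for the proof -/

section Aux

theorem skel_eq_some {x : ℤ → A} {p : ℕ} {i : ℤ} {a : A} :
    Skel x p i = some a ↔ i ∈ PerSet x p ∧ x i = a := by
  unfold Skel
  by_cases h : i ∈ PerSet x p <;> simp [h]

theorem per_add {x : ℤ → A} {p : ℕ} {i : ℤ} (k : ℤ) (h : i ∈ PerSet x p) :
    i + k * p ∈ PerSet x p := by
  intro l
  rw [h k, show i + k * p + l * p = i + (k + l) * p by ring, h]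

theorem per_add_iff {x : ℤ → A} {p : ℕ} {i : ℤ} (k : ℤ) :
    i + k * p ∈ PerSet x p ↔ i ∈ PerSet x p := by
  refine ⟨fun h => ?_, per_add k⟩
  have := per_add (-k) h
  rwa [show i + k * p + -k * p = i by ring] at this

theorem skel_per (x : ℤ → A) (p : ℕ) (i k : ℤ) : Skel x p (i + k * p) = Skel x p i := by
  ext a
  simp only [skel_eq_some, per_add_iff]
  constructor
  · rintro ⟨h, h'⟩
    exact ⟨h, by rw [← h', h k]⟩
  · rintro ⟨h, h'⟩
    exact ⟨h, by rw [← h', h k]⟩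

theorem per_mono (x : ℤ → A) {p q : ℕ} (h : p ∣ q) : PerSet x p ⊆ PerSet x q := by
  rintro i hi k
  obtain ⟨c, rfl⟩ := h
  have := hi (k * c)
  rwa [show k * (c : ℤ) * p = k * ((p * c : ℕ) : ℤ) by push_cast; ring] at this

theorem cyl_open [TopologicalSpace A] [DiscreteTopology A] (y : ℤ → A) (N : ℕ) :
    IsOpen {z : ℤ → A | ∀ i : ℤ, i.natAbs ≤ N → z i = y i} := by
  have : {z : ℤ → A | ∀ i : ℤ, i.natAbs ≤ N → z i = y i} =
      (↑(Finset.Icc (-(N : ℤ)) N) : Set ℤ).pi fun i => {y i} := by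
    ext z
    simp only [Set.mem_pi, Finset.coe_Icc, Set.mem_Icc, Set.mem_ofPred_eq, Set.mem_singleton_iff]
    exact forall_congr' fun i => imp_congr_left (by omega)
  rw [this]
  exact isOpen_set_pi (Finset.finite_toSet _) fun i _ => isOpen_discrete _

theorem exists_cyl [TopologicalSpace A] {U : Set (ℤ → A)} (hU : IsOpen U)
    {y : ℤ → A} (hy : y ∈ U) :
    ∃ N : ℕ, ∀ z : ℤ → A, (∀ i : ℤ, i.natAbs ≤ N → z i = y i) → z ∈ U := by
  rw [isOpen_pi_iff] at hU
  obtain ⟨I, u, h1, h2⟩ := hU y hy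
  refine ⟨I.sup Int.natAbs, fun z hz => h2 ?_⟩
  intro i hi
  have : i.natAbs ≤ I.sup Int.natAbs := Finset.le_sup (f := Int.natAbs) hi
  rw [hz i (by omega)]
  exact (h1 i hi).2

theorem mem_closure_window [TopologicalSpace A] [DiscreteTopology A] {S : Set (ℤ → A)}
    {y : ℤ → A} :
    y ∈ closure S ↔ ∀ N : ℕ, ∃ s ∈ S, ∀ i : ℤ, i.natAbs ≤ N → s i = y i := by
  constructor
  · intro h N
    obtain ⟨s, hs, hs'⟩ := mem_closure_iff.1 h _ (cyl_open y N) (fun i _ => rfl)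
    exact ⟨s, hs', hs⟩
  · intro h
    rw [mem_closure_iff]
    intro U hU hy
    obtain ⟨N, hN⟩ := exists_cyl hU hy
    obtain ⟨s, hs, hs'⟩ := h N
    exact ⟨s, hN s hs', hs⟩

/-- closure of the orbit of `S^j x` under `S^q`. -/
def subOrb [TopologicalSpace A] (x : ℤ → A) (q : ℕ) (j : ℤ) : Set (ℤ → A) :=
  closure (Set.range fun k : ℤ => shiftBy (j + k * q) x)

theorem exists_subOrb [TopologicalSpace A] {x y : ℤ → A} (hy : y ∈ closure (orbit x))
    {q : ℕ} (hq : 0 < q) : ∃ j : ℕ, j < q ∧ y ∈ subOrb x q j := by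
  have : orbit x ⊆ ⋃ j : Fin q, Set.range fun k : ℤ => shiftBy ((j : ℕ) + k * q) x := by
    rintro z ⟨k, rfl⟩
    have h0 : 0 ≤ k % q := Int.emod_nonneg _ (by omega)
    have h1 : k % q < q := Int.emod_lt_of_pos _ (by omega)
    rw [Set.mem_iUnion]
    refine ⟨⟨(k % q).toNat, by omega⟩, k / q, ?_⟩
    simp only [Int.toNat_of_nonneg h0]
    congr 1
    have := Int.emod_add_mul_ediv k q
    linarith [mul_comm (q : ℤ) (k / q)]
  have h2 := closure_mono this hy
  rw [closure_iUnion_of_finite, Set.mem_iUnion] at h2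
  obtain ⟨j, hj⟩ := h2
  exact ⟨j, j.2, hj⟩

theorem skel_le [TopologicalSpace A] [DiscreteTopology A] {x y : ℤ → A} {q : ℕ} {j : ℤ}
    (hy : y ∈ subOrb x q j) {i : ℤ} {a : A} (h : Skel x q (i + j) = some a) :
    Skel y q i = some a := by
  rw [skel_eq_some] at h
  have key : ∀ l : ℤ, y (i + l * q) = a := by
    intro l
    obtain ⟨s, ⟨k, rfl⟩, hs⟩ := mem_closure_window.1 hy (i + l * q).natAbs
    have := hs (i + l * q) (by omega)
    rw [← this, ← h.2, ← h.1 (l + k)]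
    simp only [shiftBy]
    congr 1
    ring
  have k0 : y i = a := by simpa using key 0
  rw [skel_eq_some]
  exact ⟨fun k => by rw [key, k0], k0⟩

theorem toep_window {x : ℤ → A} (hx : IsToeplitz x) (N : ℕ) :
    ∃ q : ℕ, 0 < q ∧ ∀ i : ℤ, i.natAbs ≤ N → i ∈ PerSet x q := by
  choose f hf1 hf2 using hx
  refine ⟨∏ i ∈ Finset.Icc (-(N : ℤ)) N, f i, Finset.prod_pos fun i _ => by
    have := hf1 i; omega, fun i hi => ?_⟩
  refine per_mono x (Finset.dvd_prod_of_mem f ?_) (hf2 i)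
  rw [Finset.mem_Icc]
  omega

theorem minimal_mem [TopologicalSpace A] [DiscreteTopology A] {x y : ℤ → A}
    (hx : IsToeplitz x) (hy : y ∈ closure (orbit x)) : x ∈ closure (orbit y) := by
  rw [mem_closure_window]
  intro N
  obtain ⟨q, hq, hN⟩ := toep_window hx N
  obtain ⟨j, -, hj⟩ := exists_subOrb hy hq
  refine ⟨shiftBy (-j) y, ⟨_, rfl⟩, fun i hi => ?_⟩
  have h1 : Skel x q (i - j + j) = some (x i) := by
    rw [sub_add_cancel, skel_eq_some]
    exact ⟨hN i hi, rfl⟩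
  exact (skel_eq_some.1 (skel_le hj h1)).2

theorem orbit_trans [TopologicalSpace A] [DiscreteTopology A] {x y z : ℤ → A}
    (h1 : x ∈ closure (orbit y)) (h2 : z ∈ closure (orbit x)) : z ∈ closure (orbit y) := by
  rw [mem_closure_window] at *
  intro N
  obtain ⟨s, ⟨k, rfl⟩, hs⟩ := h2 N
  obtain ⟨s, ⟨l, rfl⟩, hs'⟩ := h1 (N + k.natAbs)
  refine ⟨shiftBy (k + l) y, ⟨_, rfl⟩, fun i hi => ?_⟩
  rw [← hs i hi]
  have := hs' (i + k) (by omega)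
  simp only [shiftBy] at this ⊢
  rw [← this, add_assoc]

theorem self_mem_orbit (x : ℤ → A) (k : ℤ) : shiftBy k x ∈ orbit x := ⟨k, rfl⟩

theorem skel_transfer [TopologicalSpace A] [DiscreteTopology A] {x y : ℤ → A} {q : ℕ} {j : ℤ}
    (hq : 0 < q) (hx : x ∈ closure (orbit y)) (hy : y ∈ subOrb x q j) (i : ℤ) :
    Skel y q i = Skel x q (i + j) := by
  obtain ⟨j', -, hj'⟩ := exists_subOrb hx hq
  have it : ∀ (n : ℕ) (i : ℤ) (a : A), Skel x q (i + n * (j + j')) = some a →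
      Skel x q i = some a := by
    intro n
    induction n with
    | zero => intro i a h; simpa using h
    | succ n ih =>
      intro i a h
      apply skel_le hj'
      apply skel_le hy
      apply ih
      rw [← h]
      congr 1
      push_cast
      ring
  ext a
  constructor
  · intro h
    have h1 : Skel x q (i - j') = some a := by
      apply skel_le hj'
      rwa [sub_add_cancel]
    apply it (q - 1)
    rw [← h1, ← skel_per x q (i - j') (j + j')]
    congr 1
    push_cast [Nat.cast_sub hq]
    ring
  · exact fun h => skel_le hy h

theorem minper {x : ℤ → A} (hx : IsAperiodicPoint x) {N : ℕ} (hN : 0 < N)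
    (hne : (PerSet x N).Nonempty) :
    ∃ q, IsEssentialPeriod x q ∧ PerSet x q = PerSet x N := by
  classical
  have hex : ∃ q : ℕ, 0 < q ∧ Function.Periodic (Skel x N) (q : ℤ) :=
    ⟨N, hN, fun i => by simpa using skel_per x N i 1⟩
  obtain ⟨hq0, hq⟩ := Nat.find_spec hex
  have hmin := fun m => Nat.find_min hex (m := m)
  set q := Nat.find hex with hqdef
  have hdvd : q ∣ N := by
    rw [Nat.dvd_iff_mod_eq_zero]
    by_contra h
    refine hmin (N % q) (Nat.mod_lt _ hq0) ⟨Nat.pos_of_ne_zero h, ?_⟩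
    have h1 : Function.Periodic (Skel x N) (N : ℤ) := fun i => by simpa using skel_per x N i 1
    have h2 := h1.sub_period (hq.int_mul (N / q))
    have h3 : ((N % q : ℕ) : ℤ) = (N : ℤ) - (N / q : ℤ) * q := by
      push_cast
      have := Int.emod_add_mul_ediv (N : ℤ) q
      linarith [mul_comm (q : ℤ) (N / q)]
    rw [h3]
    exact h2
  have hper : PerSet x q = PerSet x N := by
    apply Subset.antisymm (per_mono x hdvd)
    intro i hi k
    have h1 := hq.int_mul k i
    have h2 : Skel x N i = some (x i) := skel_eq_some.2 ⟨hi, rfl⟩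
    rw [h2] at h1
    exact (skel_eq_some.1 h1).2
  have hsk : Skel x q = Skel x N := by
    unfold Skel
    rw [hper]
  refine ⟨q, ⟨?_, ?_⟩, hper⟩
  · by_contra h
    have h1 : q = 1 := by omega
    rw [h1] at hq hper
    obtain ⟨i0, hi0⟩ := hne
    rw [← hper] at hi0
    apply hx
    refine ⟨1, one_pos, fun i => ?_⟩
    have e1 := hi0 (i - i0)
    have e2 := hi0 (i + 1 - i0)
    simp only [Nat.cast_one, mul_one, add_sub_cancel] at e1 e2
    push_cast
    rw [e1, e2]
  · intro r hr0 hr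
    by_contra! h
    refine hmin r hr ⟨hr0, fun i => ?_⟩
    rw [← hsk]
    exact h i

theorem ess_dvd {x : ℤ → A} {p : ℕ} (hp : IsEssentialPeriod x p) {c : ℤ}
    (hc : Function.Periodic (Skel x p) c) : (p : ℤ) ∣ c := by
  have hp1 := hp.1
  have h0 : 0 ≤ c % p := Int.emod_nonneg _ (by omega)
  have h1 : c % p < p := Int.emod_lt_of_pos _ (by omega)
  by_contra h
  have h2 : c % p ≠ 0 := fun h' => h (Int.dvd_of_emod_eq_zero h')
  obtain ⟨i, hi⟩ := hp.2 (c % p).toNat (by omega) (by omega)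
  apply hi
  rw [Int.toNat_of_nonneg h0, ← hc i, ← skel_per x p (i + c % p) (c / p)]
  congr 1
  have := Int.emod_add_mul_ediv c p
  linarith [mul_comm (p : ℤ) (c / p)]

theorem ess_step {x : ℤ → A} (hT : IsToeplitz x) (hx : IsAperiodicPoint x) {p : ℕ}
    (hp : IsEssentialPeriod x p) (N : ℕ) :
    ∃ q, IsEssentialPeriod x q ∧ p ∣ q ∧ p < q ∧ ∀ i : ℤ, i.natAbs ≤ N → i ∈ PerSet x q := by
  have hp1 := hp.1
  obtain ⟨j, hj⟩ : ∃ j, j ∉ PerSet x p := by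
    by_contra! h
    exact hx ⟨p, by omega, fun i => by simpa using h i 1⟩
  obtain ⟨M, hM, hMw⟩ := toep_window hT (max N j.natAbs)
  have hw : ∀ i : ℤ, i.natAbs ≤ (max N j.natAbs : ℕ) → i ∈ PerSet x (M * p) :=
    fun i hi => per_mono x (Dvd.intro _ rfl) (hMw i hi)
  obtain ⟨q, hq, hqe⟩ := minper hx (N := M * p) (Nat.mul_pos hM (by omega))
    ⟨j, hw j (by omega)⟩
  have hsub : PerSet x p ⊆ PerSet x q := by
    rw [hqe]; exact per_mono x (Dvd.intro_left _ rfl)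
  have hper : ∀ c : ℤ, ∀ i a, Skel x p i = some a → Skel x p (i + c * q) = some a := by
    intro c i a h
    rw [skel_eq_some] at h
    have key : ∀ k : ℤ, x (i + c * q + k * p) = a := by
      intro k
      rw [show i + c * q + k * p = i + k * p + c * q by ring]
      rw [hsub (per_add k h.1) c, h.1 k, h.2]
    have k0 : x (i + c * q) = a := by simpa using key 0
    rw [skel_eq_some]
    exact ⟨fun k => by rw [key, k0], k0⟩
  have hdvd : (p : ℤ) ∣ q := by
    apply ess_dvd hp
    intro i
    ext a
    constructor
    · intro h
      have := hper (-1) _ _ h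
      rwa [show i + q + -1 * (q : ℤ) = i by ring] at this
    · intro h
      simpa using hper 1 _ _ h
  have hdvd' : p ∣ q := by exact_mod_cast hdvd
  have hjq : j ∈ PerSet x q := by rw [hqe]; exact hw j (by omega)
  have hq1 := hq.1
  refine ⟨q, hq, hdvd', lt_of_le_of_ne (Nat.le_of_dvd (by omega) hdvd') ?_, ?_⟩
  · rintro rfl
    exact hj hjq
  · intro i hi
    rw [hqe]
    exact hw i (by omega)

theorem exists_structure {x : ℤ → A} (hT : IsToeplitz x) (hx : IsAperiodicPoint x) {p : ℕ}
    (hp : IsEssentialPeriod x p) :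
    ∃ P, IsPeriodStructure x P ∧ P 0 = p ∧
      ∀ n : ℕ, ∀ i : ℤ, i.natAbs ≤ n → i ∈ PerSet x (P (n + 1)) := by
  choose f hf1 hf2 hf3 hf4 using fun (p : {p // IsEssentialPeriod x p}) (N : ℕ) =>
    ess_step hT hx p.2 N
  let P : ℕ → {p // IsEssentialPeriod x p} :=
    fun n => Nat.rec ⟨p, hp⟩ (fun n r => ⟨f r n, hf1 r n⟩) n
  have hw : ∀ n : ℕ, ∀ i : ℤ, i.natAbs ≤ n → i ∈ PerSet x (P (n + 1)).1 :=
    fun n => hf4 (P n) n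
  refine ⟨fun n => (P n).1, ⟨strictMono_nat_of_lt_succ fun n => hf3 (P n) n,
    fun n => (P n).2, fun n => hf2 (P n) n, fun i => ⟨i.natAbs + 1, hw _ i (by omega)⟩⟩, rfl, hw⟩

theorem exists_ess {x : ℤ → A} (hT : IsToeplitz x) (hx : IsAperiodicPoint x) :
    ∃ p, IsEssentialPeriod x p := by
  obtain ⟨q, hq, h⟩ := toep_window hT 0
  obtain ⟨p, hp, -⟩ := minper hx hq ⟨0, h 0 (by simp)⟩
  exact ⟨p, hp⟩

theorem ess_transfer {x y : ℤ → A} {p : ℕ} {j : ℤ} (h : ∀ i, Skel y p i = Skel x p (i + j))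
    (hy : IsEssentialPeriod x p) : IsEssentialPeriod y p := by
  refine ⟨hy.1, fun q h1 h2 => ?_⟩
  obtain ⟨i, hi⟩ := hy.2 q h1 h2
  refine ⟨i - j, ?_⟩
  rw [h, h, sub_add_cancel, show i - j + q + j = i + q by ring]
  exact hi

theorem closure_eq_of_mem [TopologicalSpace A] [DiscreteTopology A] {X : Set (ℤ → A)}
    (hX : IsToeplitzSubshift X) {y : ℤ → A} (hy : y ∈ X) : X = closure (orbit y) := by
  obtain ⟨x, hx, rfl⟩ := hX
  apply Subset.antisymm
  · intro z hz
    exact orbit_trans (minimal_mem hx hy) hz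
  · intro z hz
    exact orbit_trans hy hz

theorem scale_ess [TopologicalSpace A] [DiscreteTopology A] {X : Set (ℤ → A)}
    {p : ℕ} (hp : DividesScale X p) {x : ℤ → A} (hx : x ∈ X) :
    ∃ p', p ∣ p' ∧ IsEssentialPeriod x p' := by
  obtain ⟨x1, P, ⟨h1, h2⟩, h3, n, hn⟩ := hp
  have hess := h3.2.1 n
  refine ⟨P n, hn, ?_⟩
  have hpos : 0 < P n := by have := hess.1; omega
  obtain ⟨j, -, hj⟩ := exists_subOrb (h2 ▸ hx : x ∈ closure (orbit x1)) hpos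
  refine ess_transfer (skel_transfer hpos ?_ hj) hess
  exact minimal_mem h1 (h2 ▸ hx)

end Aux
section Forward

theorem factorAt_eq {x : ℤ → A} {i i' : ℤ} {n : ℕ} :
    factorAt x i n = factorAt x i' n ↔
      ∀ u : ℤ, 0 ≤ u → u < n → x (i + u) = x (i' + u) := by
  unfold factorAt
  rw [List.map_inj_left]
  simp only [List.bind_eq_flatMap, List.pure_def, List.mem_flatMap, List.mem_range,
    List.mem_singleton]
  constructor
  · intro h u h0 h1
    exact h u ⟨u.toNat, by omega, by omega⟩
  · rintro h u ⟨v, hv, rfl⟩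
    exact h v (by omega) (by omega)

theorem ico_sub {S : Set ℤ} {a b : ℤ} {p : ℕ} (h : b = a + p) :
    Set.Ico a b ⊆ S ↔ ∀ u : ℤ, 0 ≤ u → u < p → a + u ∈ S := by
  subst h
  constructor
  · intro h u h0 h1
    exact h ⟨by omega, by omega⟩
  · rintro h i ⟨h0, h1⟩
    have := h (i - a) (by omega) (by omega)
    rwa [add_sub_cancel] at this

/-- `y(-i)` only depends on the `r`-window of `x` around `i`. -/
def DualCode (x y : ℤ → A) (r : ℕ) : Prop :=
  ∀ i i' : ℤ, (∀ t : ℤ, t.natAbs ≤ r → x (i + t) = x (i' + t)) → y (-i) = y (-i')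

theorem dual_per {x y : ℤ → A} {r q : ℕ} (h : DualCode x y r) {i : ℤ}
    (hi : ∀ t : ℤ, t.natAbs ≤ r → i + t ∈ PerSet x q) : -i ∈ PerSet y q := by
  intro l
  rw [show -i + l * q = -(i + (-l) * q) by ring]
  apply h
  intro t ht
  rw [show i + -l * q + t = i + t + -l * q by ring]
  exact hi t ht (-l)

theorem dual_good {x y : ℤ → A} {r p q : ℕ} (h : DualCode x y r)
    (hp : ∀ t : ℤ, t.natAbs ≤ r + 1 → t ∈ PerSet x p) (hpq : p ∣ q) {e k : ℤ}
    (he : e = 0 ∨ e = 1)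
    (hg : ∀ u : ℤ, 0 ≤ u → u < p → e + k * p + u ∈ PerSet x q) (u : ℤ) (h0 : 0 ≤ u)
    (h1 : u < p) : 1 - (e + k * p) - p + u ∈ PerSet y q := by
  rw [show 1 - (e + k * p) - p + u = -(e + k * p + (p - 1 - u)) by ring]
  apply dual_per h
  intro t ht
  set s := p - 1 - u + t with hs
  rw [show e + k * p + (p - 1 - u) + t = e + k * p + s by rw [hs]; ring]
  by_cases c1 : s < 0
  · rw [show e + k * p + s = e + s + k * p by ring]
    exact per_mono x hpq (per_add k (hp _ (by omega)))
  · by_cases c2 : s < p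
    · exact hg s (by omega) c2
    · rw [show e + k * p + s = e + (s - p) + (k + 1) * p by ring]
      exact per_mono x hpq (per_add (k + 1) (hp _ (by omega)))

theorem dual_eq {x y : ℤ → A} {r p : ℕ} (h : DualCode x y r)
    (hp : ∀ t : ℤ, t.natAbs ≤ r + 1 → t ∈ PerSet x p) {e k k' : ℤ}
    (he : e = 0 ∨ e = 1)
    (hg : ∀ u : ℤ, 0 ≤ u → u < p → x (e + k * p + u) = x (e + k' * p + u)) (u : ℤ) (h0 : 0 ≤ u)
    (h1 : u < p) : y (1 - (e + k * p) - p + u) = y (1 - (e + k' * p) - p + u) := by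
  rw [show 1 - (e + k * p) - p + u = -(e + k * p + (p - 1 - u)) by ring,
    show 1 - (e + k' * p) - p + u = -(e + k' * p + (p - 1 - u)) by ring]
  apply h
  intro t ht
  set s := p - 1 - u + t with hs
  rw [show e + k * p + (p - 1 - u) + t = e + k * p + s by rw [hs]; ring,
    show e + k' * p + (p - 1 - u) + t = e + k' * p + s by rw [hs]; ring]
  by_cases c1 : s < 0
  · rw [show e + k * p + s = e + s + k * p by ring, show e + k' * p + s = e + s + k' * p by ring]
    have := hp (e + s) (by omega)
    rw [this, this]
  · by_cases c2 : s < p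
    · exact hg s (by omega) c2
    · rw [show e + k * p + s = e + (s - p) + (k + 1) * p by ring,
        show e + k' * p + s = e + (s - p) + (k' + 1) * p by ring]
      have := hp (e + (s - p)) (by omega)
      rw [this, this]

theorem nice_of_dual {x y : ℤ → A} {r p q : ℕ} (h1 : DualCode x y r) (h2 : DualCode y x r)
    (hp : ∀ t : ℤ, t.natAbs ≤ 2 * r + 1 → t ∈ PerSet x p) (hpq : p ∣ q) (hq : 0 < q)
    {j : ℤ} (hj : ∀ i, Skel y q i = Skel x q (i + j)) : NiceSymmetries x p q := by
  have hpx : ∀ t : ℤ, t.natAbs ≤ r + 1 → t ∈ PerSet x p := fun t ht => hp t (by omega)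
  have hpy : ∀ t : ℤ, t.natAbs ≤ r + 1 → t ∈ PerSet y p := by
    intro t ht
    have : - -t ∈ PerSet y p := dual_per h1 fun s hs => hp _ (by omega)
    rwa [neg_neg] at this
  obtain ⟨j0, hj0, hj1, hjj⟩ : ∃ j0 : ℤ, 1 ≤ j0 ∧ j0 ≤ q ∧
      ∀ i, Skel y q i = Skel x q (i + j0) := by
    refine ⟨(j - 1) % q + 1, ?_, ?_, fun i => ?_⟩
    · have := Int.emod_nonneg (j - 1) (b := q) (by omega)
      omega
    · have := Int.emod_lt_of_pos (j - 1) (b := q) (by omega)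
      omega
    · rw [hj, ← skel_per x q (i + ((j - 1) % q + 1)) ((j - 1) / q)]
      congr 1
      have := Int.emod_add_mul_ediv (j - 1) q
      linarith [mul_comm (q : ℤ) ((j - 1) / q)]
  have hmem : ∀ i, i ∈ PerSet y q ↔ i + j0 ∈ PerSet x q := by
    intro i
    constructor
    · intro hi
      have : Skel y q i = some (y i) := skel_eq_some.2 ⟨hi, rfl⟩
      rw [hjj] at this
      exact (skel_eq_some.1 this).1
    · intro hi
      have : Skel x q (i + j0) = some (x (i + j0)) := skel_eq_some.2 ⟨hi, rfl⟩
      rw [← hjj] at this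
      exact (skel_eq_some.1 this).1
  have hval : ∀ i, i ∈ PerSet y q → y i = x (i + j0) := by
    intro i hi
    have : Skel x q (i + j0) = some (x (i + j0)) := skel_eq_some.2 ⟨(hmem i).1 hi, rfl⟩
    rw [← hjj] at this
    exact (skel_eq_some.1 this).2
  have good : ∀ k : ℤ, (∀ u : ℤ, 0 ≤ u → u < p → 0 + k * p + u ∈ PerSet x q) ↔
      (∀ u : ℤ, 0 ≤ u → u < p → 1 - (0 + k * p) - p + u ∈ PerSet y q) := by
    intro k
    constructor
    · intro hg
      exact dual_good h1 hpx hpq (Or.inl rfl) hg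
    · intro hg u hu0 hu1
      have := dual_good (e := 1) (k := -k - 1) h2 hpy hpq (Or.inr rfl) (fun u hu0 hu1 => by
        have := hg u hu0 hu1
        rwa [show 1 - (0 + k * p) - p + u = 1 + (-k - 1) * p + u by ring] at this) u hu0 hu1
      rwa [show 1 - (1 + (-k - 1) * p) - p + u = 0 + k * p + u by ring] at this
  have beq : ∀ k k' : ℤ, (∀ u : ℤ, 0 ≤ u → u < p → x (0 + k * p + u) = x (0 + k' * p + u)) ↔
      (∀ u : ℤ, 0 ≤ u → u < p →
        y (1 - (0 + k * p) - p + u) = y (1 - (0 + k' * p) - p + u)) := by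
    intro k k'
    constructor
    · intro hg
      exact dual_eq h1 hpx (Or.inl rfl) hg
    · intro hg u hu0 hu1
      have := dual_eq (e := 1) (k := -k - 1) (k' := -k' - 1) h2 hpy (Or.inr rfl)
        (fun u hu0 hu1 => by
        have := hg u hu0 hu1
        rwa [show 1 - (0 + k * p) - p + u = 1 + (-k - 1) * p + u by ring,
          show 1 - (0 + k' * p) - p + u = 1 + (-k' - 1) * p + u by ring] at this) u hu0 hu1
      rwa [show 1 - (1 + (-k - 1) * p) - p + u = 0 + k * p + u by ring,
        show 1 - (1 + (-k' - 1) * p) - p + u = 0 + k' * p + u by ring] at this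
  have conv : ∀ (k : ℕ) (u : ℤ), j0 + 1 - ((k + 1) * p : ℕ) + u =
      1 - (0 + (k : ℤ) * p) - p + u + j0 := by
    intro k u
    push_cast
    ring
  have conv2 : ∀ (k : ℕ) (u : ℤ), ((k * p : ℕ) : ℤ) + u = 0 + (k : ℤ) * p + u := by
    intro k u
    push_cast
    ring
  refine ⟨j0 + 1, by omega, by omega, fun k _ => ?_, fun k k' _ _ hk hk' => ?_⟩
  · rw [ico_sub (p := p) (by push_cast; ring), ico_sub (p := p) (by push_cast; ring)]
    simp only [conv, conv2, ← hmem]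
    exact good k
  · rw [ico_sub (p := p) (by push_cast; ring)] at hk hk'
    simp only [conv2] at hk hk'
    rw [factorAt_eq, factorAt_eq]
    simp only [conv, conv2]
    rw [beq]
    refine forall_congr' fun u => forall_congr' fun hu0 => forall_congr' fun hu1 => ?_
    rw [hval _ ((good k).1 hk u hu0 hu1), hval _ ((good k').1 hk' u hu0 hu1)]

theorem chl [TopologicalSpace A] [DiscreteTopology A] {X : Set (ℤ → A)} (hX : IsCompact X)
    {φ : ↥X → ↥X} (hφ : Continuous φ) :
    ∃ r : ℕ, ∀ u v : ↥X, (∀ i : ℤ, i.natAbs ≤ r → u.1 i = v.1 i) →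
      (φ u).1 0 = (φ v).1 0 := by
  have hg : Continuous fun u : ↥X => (φ u).1 0 :=
    (continuous_apply 0).comp (continuous_subtype_val.comp hφ)
  have h1 : ∀ w : ↥X, ∃ N : ℕ, ∀ u : ↥X, (∀ i : ℤ, i.natAbs ≤ N → u.1 i = w.1 i) →
      (φ u).1 0 = (φ w).1 0 := by
    intro w
    have ho := (isOpen_discrete {(φ w).1 0}).preimage hg
    obtain ⟨U, hU, hUe⟩ := isOpen_induced_iff.1 ho
    have hw : w.1 ∈ U := by
      have : w ∈ Subtype.val ⁻¹' U := by rw [hUe]; rfl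
      exact this
    obtain ⟨N, hN⟩ := exists_cyl hU hw
    refine ⟨N, fun u hu => ?_⟩
    have : u ∈ Subtype.val ⁻¹' U := hN _ hu
    rw [hUe] at this
    exact this
  choose N hN using h1
  have : CompactSpace ↥X := isCompact_iff_compactSpace.1 hX
  obtain ⟨t, -, ht⟩ := (isCompact_univ (X := ↥X)).elim_nhds_subcover
    (fun w => {u : ↥X | ∀ i : ℤ, i.natAbs ≤ N w → u.1 i = w.1 i}) (fun w _ =>
      ((cyl_open w.1 (N w)).preimage continuous_subtype_val).mem_nhds (fun i _ => rfl))
  refine ⟨t.sup N, fun u v huv => ?_⟩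
  have hu := ht (mem_univ u)
  simp only [Set.mem_iUnion] at hu
  obtain ⟨w, hw, hu⟩ := hu
  have hle : N w ≤ t.sup N := Finset.le_sup hw
  rw [hN w u hu, hN w v]
  intro i hi
  rw [← huv i (hi.trans hle)]
  exact hu i hi

theorem shiftBy_shiftBy (k l : ℤ) (x : ℤ → A) : shiftBy k (shiftBy l x) = shiftBy (k + l) x := by
  funext i
  simp only [shiftBy, add_assoc]

theorem shiftBy_zero (x : ℤ → A) : shiftBy 0 x = x := by
  funext i
  simp [shiftBy]

theorem mem_shiftBy [TopologicalSpace A] [DiscreteTopology A] {X : Set (ℤ → A)}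
    (hX : IsToeplitzSubshift X) {y : ℤ → A} (hy : y ∈ X) (k : ℤ) : shiftBy k y ∈ X := by
  rw [closure_eq_of_mem hX hy]
  exact subset_closure ⟨k, rfl⟩

theorem equi_all {X : Set (ℤ → A)} (hinv : ∀ y ∈ X, ∀ k, shiftBy k y ∈ X) {φ : ↥X → ↥X}
    (hφ : ∀ (x : ℤ → A) (hx : x ∈ X) (hx' : shift x ∈ X),
      (φ ⟨shift x, hx'⟩).1 = shiftInv (φ ⟨x, hx⟩).1) (k : ℤ) (x : ℤ → A) (hx : x ∈ X) :
    (φ ⟨shiftBy k x, hinv x hx k⟩).1 = shiftBy (-k) (φ ⟨x, hx⟩).1 := by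
  have nat : ∀ (n : ℕ) (x : ℤ → A) (hx : x ∈ X) (hx' : shiftBy n x ∈ X),
      (φ ⟨shiftBy n x, hx'⟩).1 = shiftBy (-n) (φ ⟨x, hx⟩).1 := by
    intro n
    induction n with
    | zero =>
      intro x hx hx'
      simp only [Nat.cast_zero, neg_zero, shiftBy_zero]
    | succ n ih =>
      intro x hx hx'
      have e : shiftBy ((n + 1 : ℕ) : ℤ) x = shift (shiftBy n x) := by
        funext i
        simp only [shiftBy, shift]
        congr 1
        push_cast
        ring
      simp only [e]
      rw [hφ (shiftBy n x) (hinv x hx n), ih x hx]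
      funext i
      simp only [shiftInv, shiftBy]
      exact congrArg _ (by push_cast; ring)
  obtain ⟨n, rfl | rfl⟩ := k.eq_nat_or_neg
  · exact nat n x hx _
  · have := nat n (shiftBy (-n) x) (hinv x hx _) (hinv _ (hinv x hx _) _)
    simp only [shiftBy_shiftBy, add_neg_cancel, shiftBy_zero] at this
    rw [this, shiftBy_shiftBy, neg_neg, add_neg_cancel, shiftBy_zero]

theorem dual_of_code {X : Set (ℤ → A)} (hinv : ∀ y ∈ X, ∀ k, shiftBy k y ∈ X) {φ : ↥X → ↥X}
    (hφ : ∀ (x : ℤ → A) (hx : x ∈ X) (hx' : shift x ∈ X),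
      (φ ⟨shift x, hx'⟩).1 = shiftInv (φ ⟨x, hx⟩).1) {r r' : ℕ} (hr : r ≤ r')
    (hc : ∀ u v : ↥X, (∀ i : ℤ, i.natAbs ≤ r → u.1 i = v.1 i) → (φ u).1 0 = (φ v).1 0)
    (x : ↥X) : DualCode x.1 (φ x).1 r' := by
  intro i i' h
  have key := hc ⟨shiftBy i x.1, hinv _ x.2 i⟩ ⟨shiftBy i' x.1, hinv _ x.2 i'⟩ (by
    intro t ht
    have := h t (ht.trans hr)
    simpa only [shiftBy, add_comm] using this)
  rw [equi_all hinv hφ i x.1 x.2, equi_all hinv hφ i' x.1 x.2] at key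
  simpa [shiftBy] using key

theorem forward [Finite A] [TopologicalSpace A] [DiscreteTopology A]
    {X : Set (ℤ → A)} (hX : IsToeplitzSubshift X)
    (hap : ∀ x ∈ X, IsAperiodicPoint x) (hc : ConjugateBy X X shift shiftInv)
    (x : ℤ → A) (hx : x ∈ X) (hT : IsToeplitz x) : NiceSymAll X x := by
  obtain ⟨φ, hφ⟩ := hc
  have hcl : X = closure (orbit x) := closure_eq_of_mem hX hx
  have hcomp : IsCompact X := by
    rw [hcl]
    exact isClosed_closure.isCompact
  have hinv : ∀ y ∈ X, ∀ k, shiftBy k y ∈ X := fun y hy k => mem_shiftBy hX hy k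
  have hψ : ∀ (x : ℤ → A) (hx : x ∈ X) (hx' : shift x ∈ X),
      (φ.symm ⟨shift x, hx'⟩).1 = shiftInv (φ.symm ⟨x, hx⟩).1 := by
    intro x hx hx'
    set w := φ.symm ⟨x, hx⟩ with hw
    have h1 : shiftInv w.1 ∈ X := hinv w.1 w.2 (-1)
    have e1 : shift (shiftInv w.1) = w.1 := by
      funext i
      simp [shift, shiftInv]
    have h2 := hφ (shiftInv w.1) h1 (by rw [e1]; exact w.2)
    simp only [e1] at h2
    have h3 : φ ⟨w.1, w.2⟩ = ⟨x, hx⟩ := by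
      rw [hw]
      exact φ.apply_symm_apply _
    rw [h3] at h2
    have h4 : φ ⟨shiftInv w.1, h1⟩ = ⟨shift x, hx'⟩ := by
      apply Subtype.ext
      change _ = shift x
      change x = _ at h2
      rw [h2]
      funext i
      simp [shift, shiftInv]
    rw [← h4, φ.symm_apply_apply]
  obtain ⟨r1, hr1⟩ := chl hcomp φ.continuous
  obtain ⟨r2, hr2⟩ := chl hcomp φ.symm.continuous
  set r := max r1 r2
  set y := φ ⟨x, hx⟩ with hy
  have d1 : DualCode x y.1 r := dual_of_code hinv hφ (le_max_left _ _) hr1 ⟨x, hx⟩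
  have d2 : DualCode y.1 x r := by
    have := dual_of_code hinv hψ (le_max_right r1 _) hr2 y
    rwa [hy, φ.symm_apply_apply] at this
  obtain ⟨p0, hp0⟩ := exists_ess hT (hap x hx)
  obtain ⟨P, hP, -, hPw⟩ := exists_structure hT (hap x hx) hp0
  have hpos : 0 < P (2 * r + 1 + 1) := by
    have := (hP.2.1 (2 * r + 1 + 1)).1
    omega
  refine ⟨P (2 * r + 1 + 1), hpos, ⟨x, P, ⟨hT, hcl⟩, hP, _, dvd_rfl⟩, fun q hq hpq _ => ?_⟩
  have hyx : y.1 ∈ closure (orbit x) := by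
    rw [← hcl]
    exact y.2
  obtain ⟨j, -, hj⟩ := exists_subOrb hyx (by omega : 0 < q)
  exact nice_of_dual d1 d2 (hPw _) hpq (by omega)
    (skel_transfer (by omega) (minimal_mem hT hyx) hj)

end Forward
section Backward

/-- The block of length `p` of `y` at position `c`. -/
def blk (p : ℕ) (y : ℤ → A) (c : ℤ) : Fin p → A := fun u => y (c + (u : ℕ))

theorem blk_eq {p : ℕ} {y z : ℤ → A} {c c' : ℤ} :
    blk p y c = blk p z c' ↔ ∀ u : ℤ, 0 ≤ u → u < p → y (c + u) = z (c' + u) := by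
  constructor
  · intro h u h0 h1
    have := congrFun h ⟨u.toNat, by omega⟩
    simpa only [blk, Int.toNat_of_nonneg h0] using this
  · intro h
    funext u
    exact h _ (by omega) (by omega)

theorem nice_psi {x : ℤ → A} {p q : ℕ} (h : NiceSymmetries x p q) (hpq : p ∣ q) (hp : 0 < p)
    (hq : 0 < q) :
    ∃ (ψ : (Fin p → A) → (Fin p → A)) (m : ℤ),
      (∀ k : ℤ, (∀ u : ℤ, 0 ≤ u → u < p → k * p + u ∈ PerSet x q) →
        ψ (blk p x (k * p)) = blk p x (m - (k + 1) * p)) ∧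
      (∀ k k' : ℤ, (∀ u : ℤ, 0 ≤ u → u < p → k * p + u ∈ PerSet x q) →
        (∀ u : ℤ, 0 ≤ u → u < p → k' * p + u ∈ PerSet x q) →
        ψ (blk p x (k * p)) = ψ (blk p x (k' * p)) → blk p x (k * p) = blk p x (k' * p)) := by
  classical
  obtain ⟨m, -, -, ha, hb⟩ := h
  obtain ⟨c, rfl⟩ := hpq
  have hc : 0 < c := Nat.pos_of_mul_pos_left hq
  rw [Nat.mul_div_cancel_left _ hp] at ha hb
  have red : ∀ k : ℤ, (∀ u : ℤ, 0 ≤ u → u < p → k * p + u ∈ PerSet x (p * c)) →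
      ∃ k0 : ℕ, k0 < c ∧
        Set.Ico ((k0 * p : ℕ) : ℤ) (((k0 + 1) * p : ℕ) : ℤ) ⊆ PerSet x (p * c) ∧
        blk p x (k * p) = blk p x ((k0 * p : ℕ) : ℤ) ∧
        blk p x (m - (k + 1) * p) = blk p x (m - ((k0 + 1) * p : ℕ)) := by
    intro k hk
    have e0 : 0 ≤ k % c := Int.emod_nonneg _ (by omega)
    have e1 : k % c < c := Int.emod_lt_of_pos _ (by omega)
    have e2 := Int.emod_add_mul_ediv k c
    obtain ⟨k0, hk0⟩ := Int.eq_ofNat_of_zero_le e0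
    set l := k / c
    rw [hk0] at e1 e2
    have g0 : Set.Ico ((k0 * p : ℕ) : ℤ) (((k0 + 1) * p : ℕ) : ℤ) ⊆ PerSet x (p * c) := by
      rw [ico_sub (p := p) (by push_cast; ring)]
      intro u h0 h1
      rw [← per_add_iff l]
      convert hk u h0 h1 using 1
      rw [← e2]
      push_cast
      ring
    have g1 := (ha k0 (by omega)).1 g0
    refine ⟨k0, by omega, g0, ?_, ?_⟩
    · rw [blk_eq]
      intro u h0 h1
      rw [← hk u h0 h1 (-l)]
      congr 1
      rw [← e2]
      push_cast
      ring
    · rw [ico_sub (p := p) (by push_cast; ring)] at g1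
      rw [blk_eq]
      intro u h0 h1
      rw [← g1 u h0 h1 (-l)]
      congr 1
      rw [← e2]
      push_cast
      ring
  have key : ∀ k k' : ℤ, (∀ u : ℤ, 0 ≤ u → u < p → k * p + u ∈ PerSet x (p * c)) →
      (∀ u : ℤ, 0 ≤ u → u < p → k' * p + u ∈ PerSet x (p * c)) →
      (blk p x (k * p) = blk p x (k' * p) ↔
        blk p x (m - (k + 1) * p) = blk p x (m - (k' + 1) * p)) := by
    intro k k' hk hk'
    obtain ⟨k0, a1, a2, a3, a4⟩ := red k hk
    obtain ⟨k0', b1, b2, b3, b4⟩ := red k' hk'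
    rw [a3, a4, b3, b4]
    have := hb k0 k0' a1 b1 a2 b2
    rw [factorAt_eq, factorAt_eq] at this
    rw [blk_eq, blk_eq]
    exact this
  let ψ : (Fin p → A) → (Fin p → A) := fun w =>
    if h : ∃ k : ℤ, (∀ u : ℤ, 0 ≤ u → u < p → k * p + u ∈ PerSet x (p * c)) ∧
      blk p x (k * p) = w then blk p x (m - (h.choose + 1) * p) else w
  have hψ : ∀ k : ℤ, (∀ u : ℤ, 0 ≤ u → u < p → k * p + u ∈ PerSet x (p * c)) →
        ψ (blk p x (k * p)) = blk p x (m - (k + 1) * p) := by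
    intro k hk
    have hex : ∃ k' : ℤ, (∀ u : ℤ, 0 ≤ u → u < p → k' * p + u ∈ PerSet x (p * c)) ∧
      blk p x (k' * p) = blk p x (k * p) := ⟨k, hk, rfl⟩
    have h1 : ψ (blk p x (k * p)) = blk p x (m - (hex.choose + 1) * p) := dif_pos hex
    rw [h1]
    exact (key _ _ hex.choose_spec.1 hk).1 hex.choose_spec.2
  refine ⟨ψ, m, hψ, fun k k' hk hk' he => ?_⟩
  rw [hψ k hk, hψ k' hk'] at he
  exact (key k k' hk hk').2 he

theorem exists_psi [Finite A] {x : ℤ → A} {p : ℕ} (hp : 0 < p) {P : ℕ → ℕ}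
    (hP : ∀ n, p ∣ P (n + 1)) (hP0 : ∀ n, 0 < P (n + 1))
    (hw : ∀ n : ℕ, ∀ i : ℤ, i.natAbs ≤ n → i ∈ PerSet x (P (n + 1)))
    (hn : ∀ n, NiceSymmetries x p (P (n + 1))) :
    ∃ ψ : (Fin p → A) → (Fin p → A),
      (∀ k k' : ℤ, ψ (blk p x (k * p)) = ψ (blk p x (k' * p)) →
        blk p x (k * p) = blk p x (k' * p)) ∧
      ∀ N : ℕ, ∃ m : ℤ, ∀ k : ℤ, k.natAbs ≤ N →
        ψ (blk p x (k * p)) = blk p x (m - (k + 1) * p) := by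
  choose ψ m h1 h2 using fun n => nice_psi (hn n) (hP n) hp (hP0 n)
  obtain ⟨ψ0, hψ0⟩ := Finite.exists_infinite_fiber ψ
  have hinf : (ψ ⁻¹' {ψ0}).Infinite := Set.infinite_coe_iff.1 hψ0
  have good : ∀ (N n : ℕ), (N + 1) * p < n → ∀ k : ℤ, k.natAbs ≤ N →
      ∀ u : ℤ, 0 ≤ u → u < p → k * p + u ∈ PerSet x (P (n + 1)) := by
    intro N n hn k hk u h0 h1
    apply hw
    have e1 : (k * p).natAbs ≤ N * p := by
      rw [Int.natAbs_mul, Int.natAbs_natCast]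
      exact Nat.mul_le_mul_right _ hk
    have e2 : (N + 1) * p = N * p + p := by ring
    omega
  refine ⟨ψ0, fun k k' he => ?_, fun N => ?_⟩
  · obtain ⟨n, hn1, hn2⟩ := hinf.exists_gt ((max k.natAbs k'.natAbs + 1) * p)
    have hn1 : ψ n = ψ0 := hn1
    rw [← hn1] at he
    exact h2 n k k' (good _ n hn2 k (by omega)) (good _ n hn2 k' (by omega)) he
  · obtain ⟨n, hn1, hn2⟩ := hinf.exists_gt ((N + 1) * p)
    have hn1 : ψ n = ψ0 := hn1
    refine ⟨m n, fun k hk => ?_⟩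
    rw [← hn1]
    exact h1 n k (good N n hn2 k hk)

/-- Reverse blocks of `y` (cut at phase `-a`) and recode each of them with `ψ`. -/
def Fmap (p : ℕ) (hp : 0 < p) (ψ : (Fin p → A) → (Fin p → A)) (a : ℤ) (y : ℤ → A) : ℤ → A :=
  fun i => ψ (blk p y ((-((i - a) / p) - 1) * p - a))
    ⟨((i - a) % p).toNat, by
      have h0 := Int.emod_nonneg (i - a) (b := p) (by omega)
      have h1 := Int.emod_lt_of_pos (i - a) (b := p) (by omega)
      omega⟩

theorem Fmap_apply {p : ℕ} (hp : 0 < p) (ψ : (Fin p → A) → (Fin p → A)) (a : ℤ) (y : ℤ → A)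
    (k : ℤ) (t : Fin p) :
    Fmap p hp ψ a y (a - (k + 1) * p + (t : ℕ)) = ψ (blk p y (k * p - a)) t := by
  have ht := t.2
  have e0 : a - (k + 1) * p + (t : ℕ) - a = (t : ℕ) + p * (-(k + 1)) := by ring
  have e1 : (a - (k + 1) * p + (t : ℕ) - a) / p = -(k + 1) := by
    rw [e0, Int.add_mul_ediv_left _ _ (by omega), Int.ediv_eq_zero_of_lt (by omega) (by omega),
      zero_add]
  have e2 : (a - (k + 1) * p + (t : ℕ) - a) % p = (t : ℕ) := by
    rw [e0, Int.add_mul_emod_self_left, Int.emod_eq_of_lt (by omega) (by omega)]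
  unfold Fmap
  simp only [e1, e2]
  congr 2
  ring

theorem Fmap_decomp {p : ℕ} (hp : 0 < p) (a i : ℤ) :
    ∃ (k : ℤ) (t : Fin p), i = a - (k + 1) * p + (t : ℕ) ∧ k.natAbs ≤ (i - a).natAbs + 1 := by
  have h0 := Int.emod_nonneg (i - a) (b := p) (by omega)
  have h1 := Int.emod_lt_of_pos (i - a) (b := p) (by omega)
  have h2 := Int.emod_add_mul_ediv (i - a) p
  refine ⟨-((i - a) / p) - 1, ⟨((i - a) % p).toNat, by omega⟩, ?_, ?_⟩
  · simp only [Int.toNat_of_nonneg h0]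
    linarith [mul_comm (p : ℤ) ((i - a) / p)]
  · have hp' : (1 : ℤ) ≤ p := by omega
    set d := (i - a) / p
    by_cases hd : 0 ≤ d
    · have : d ≤ p * d := by nlinarith
      omega
    · have : -d - 1 ≤ p * (-d - 1) := by nlinarith
      have e : (p : ℤ) * (-d - 1) = -(p * d) - p := by ring
      omega

theorem Fmap_period {p : ℕ} (hp : 0 < p) (ψ : (Fin p → A) → (Fin p → A)) (a c : ℤ) (y : ℤ → A) :
    Fmap p hp ψ (a + c * p) y = Fmap p hp ψ a y := by
  funext i
  obtain ⟨k, t, rfl, -⟩ := Fmap_decomp hp a i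
  rw [Fmap_apply]
  rw [show a - (k + 1) * p + (t : ℕ) = a + c * p - (k + c + 1) * p + (t : ℕ) by ring, Fmap_apply]
  congr 2
  ring

theorem Fmap_shift {p : ℕ} (hp : 0 < p) (ψ : (Fin p → A) → (Fin p → A)) (a k : ℤ) (y : ℤ → A) :
    Fmap p hp ψ (a + k) (shiftBy k y) = shiftBy (-k) (Fmap p hp ψ a y) := by
  funext i
  obtain ⟨l, t, rfl, -⟩ := Fmap_decomp hp (a + k) i
  have e : blk p (shiftBy k y) (l * p - (a + k)) = blk p y (l * p - a) := by
    funext u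
    simp only [blk, shiftBy]
    congr 1
    ring
  rw [Fmap_apply, e]
  change _ = Fmap p hp ψ a y (a + k - (l + 1) * p + (t : ℕ) + -k)
  rw [show a + k - (l + 1) * p + (t : ℕ) + -k = a - (l + 1) * p + (t : ℕ) by ring, Fmap_apply]

theorem Fmap_continuous [TopologicalSpace A] [DiscreteTopology A] {p : ℕ} (hp : 0 < p)
    (ψ : (Fin p → A) → (Fin p → A)) (a : ℤ) : Continuous (Fmap p hp ψ a) := by
  refine continuous_pi fun i => ?_
  unfold Fmap
  have hb : Continuous fun y : ℤ → A => blk p y ((-((i - a) / p) - 1) * p - a) :=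
    continuous_pi fun u => continuous_apply _
  exact (continuous_apply _).comp ((continuous_of_discreteTopology (f := ψ)).comp hb)

theorem subOrb_shift [TopologicalSpace A] [DiscreteTopology A] {x y : ℤ → A} {q : ℕ} {j : ℤ}
    (hy : y ∈ subOrb x q j) (k : ℤ) : shiftBy k y ∈ subOrb x q (j + k) := by
  unfold subOrb at *
  rw [mem_closure_window] at *
  intro N
  obtain ⟨s, ⟨l, rfl⟩, hs⟩ := hy (N + k.natAbs)
  refine ⟨_, ⟨l, rfl⟩, fun i hi => ?_⟩
  have := hs (i + k) (by omega)
  simp only [shiftBy] at this ⊢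
  rw [← this]
  congr 1
  ring

theorem exists_phase [TopologicalSpace A] [DiscreteTopology A] {X : Set (ℤ → A)}
    (hX : IsToeplitzSubshift X) {x : ℤ → A} (hx : x ∈ X) {p p' : ℕ}
    (hpp : p ∣ p') (hess : IsEssentialPeriod x p') :
    ∃ π : ↥X → ZMod p, IsLocallyConstant π ∧ π ⟨x, hx⟩ = 0 ∧
      (∀ (y : ↥X) (k : ℤ) (h : shiftBy k y.1 ∈ X), π ⟨shiftBy k y.1, h⟩ = π y + k) ∧
      ∀ (y : ↥X) (a : ℤ), π y = a → ∀ k : ℤ, ∃ k' : ℤ,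
        blk p y.1 (k * p - a) = blk p x (k' * p) := by
  have hpos : 0 < p' := by have := hess.1; omega
  have hmem : ∀ y : ↥X, ∃ j : ℕ, j < p' ∧ y.1 ∈ subOrb x p' j := fun y =>
    exists_subOrb (by rw [← closure_eq_of_mem hX hx]; exact y.2) hpos
  choose f hf1 hf2 using hmem
  have huniq : ∀ (y : ↥X) (j j' : ℤ), y.1 ∈ subOrb x p' j → y.1 ∈ subOrb x p' j' →
      (p' : ℤ) ∣ j - j' := by
    intro y j j' h1 h2
    have hxy : x ∈ closure (orbit y.1) := by rw [← closure_eq_of_mem hX y.2]; exact hx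
    apply ess_dvd hess
    intro i
    have e1 := skel_transfer hpos hxy h1 (i - j')
    have e2 := skel_transfer hpos hxy h2 (i - j')
    rw [sub_add_cancel] at e2
    rw [← e2, e1]
    congr 1
    ring
  have hcast : ∀ (y : ↥X) (j : ℤ), y.1 ∈ subOrb x p' j → ((f y : ℕ) : ZMod p) = (j : ZMod p) := by
    intro y j hj
    have h1 := huniq y _ _ hj (hf2 y)
    have h2 : (p : ℤ) ∣ j - (f y : ℤ) := (Int.natCast_dvd_natCast.2 hpp).trans h1
    have h3 := (ZMod.intCast_eq_intCast_iff_dvd_sub (f y : ℤ) j p).2 h2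
    simpa using h3
  refine ⟨fun y => (f y : ZMod p), ?_, ?_, ?_, ?_⟩
  · intro s
    rw [← isClosed_compl_iff]
    have : ((fun y : ↥X => (f y : ZMod p)) ⁻¹' s)ᶜ =
        ⋃ j ∈ {j : ℕ | j < p' ∧ (j : ZMod p) ∉ s}, Subtype.val ⁻¹' (subOrb x p' (j : ℤ)) := by
      ext y
      simp only [Set.mem_compl_iff, Set.mem_preimage, Set.mem_iUnion, exists_prop]
      constructor
      · intro h
        exact ⟨f y, ⟨hf1 y, h⟩, hf2 y⟩
      · rintro ⟨j, ⟨h1, h2⟩, h3⟩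
        rw [hcast y j h3]
        simpa using h2
    rw [this]
    apply Set.Finite.isClosed_biUnion
    · exact (Set.finite_lt_nat p').subset fun j hj => hj.1
    · intro j _
      exact isClosed_closure.preimage continuous_subtype_val
  · have := hcast ⟨x, hx⟩ 0 (subset_closure ⟨0, by simp [shiftBy_zero]⟩)
    simpa using this
  · intro y k h
    have := hcast ⟨shiftBy k y.1, h⟩ _ (subOrb_shift (hf2 y) k)
    simpa using this
  · intro y a ha k
    have h1 : ((f y : ℤ) : ZMod p) = (a : ZMod p) := by simpa using ha
    rw [eq_comm, ZMod.intCast_eq_intCast_iff_dvd_sub] at h1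
    obtain ⟨c, hc⟩ := h1
    obtain ⟨d, hd⟩ := hpp
    obtain ⟨s, ⟨l, rfl⟩, hs⟩ := mem_closure_window.1 (hf2 y) ((k * p - a).natAbs + p)
    refine ⟨k + c + l * d, ?_⟩
    rw [blk_eq]
    intro u h0 h1
    rw [← hs _ (by omega)]
    simp only [shiftBy]
    congr 1
    have hd' : (p' : ℤ) = p * d := by exact_mod_cast hd
    rw [hd']
    linear_combination hc

theorem dense_ind [TopologicalSpace A] {X : Set (ℤ → A)}
    {x : ℤ → A} (hX : X ⊆ closure (orbit x)) (hinv : ∀ k, shiftBy k x ∈ X) {C : Set ↥X}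
    (hC : IsClosed C) (h : ∀ k, (⟨shiftBy k x, hinv k⟩ : ↥X) ∈ C) (y : ↥X) : y ∈ C := by
  have hd : Dense {z : ↥X | z.1 ∈ orbit x} := by
    rw [Subtype.dense_iff]
    intro z hz
    refine closure_mono ?_ (hX hz)
    rintro w ⟨k, rfl⟩
    exact ⟨⟨_, hinv k⟩, ⟨k, rfl⟩, rfl⟩
  have hsub : {z : ↥X | z.1 ∈ orbit x} ⊆ C := by
    rintro ⟨z, hz⟩ ⟨k, hk⟩
    have hk : z = shiftBy k x := hk
    subst hk
    exact h k
  exact closure_minimal hsub hC (hd y)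

theorem backward [Finite A] [TopologicalSpace A] [DiscreteTopology A]
    {X : Set (ℤ → A)} (hX : IsToeplitzSubshift X)
    (hap : ∀ x ∈ X, IsAperiodicPoint x)
    {x : ℤ → A} (hx : x ∈ X) (hT : IsToeplitz x) (hN : NiceSymAll X x) :
    ConjugateBy X X shift shiftInv := by
  obtain ⟨p, hp, hscale, hnice⟩ := hN
  obtain ⟨p', hpp, hess⟩ := scale_ess hscale hx
  have hcl : ∀ y ∈ X, X = closure (orbit y) := fun y hy => closure_eq_of_mem hX hy
  have hinv : ∀ y ∈ X, ∀ k, shiftBy k y ∈ X := fun y hy k => mem_shiftBy hX hy k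
  have hclosed : IsClosed X := by rw [hcl x hx]; exact isClosed_closure
  have : CompactSpace ↥X := isCompact_iff_compactSpace.1 hclosed.isCompact
  have : NeZero p := ⟨by omega⟩
  obtain ⟨P, hP, hP0, hPw⟩ := exists_structure hT (hap x hx) hess
  have hPdvd : ∀ n, p ∣ P n := by
    intro n
    induction n with
    | zero => rw [hP0]; exact hpp
    | succ n ih => exact ih.trans (hP.2.2.1 n)
  have hPpos : ∀ n, 0 < P n := fun n => by
    have := (hP.2.1 n).1
    omega
  obtain ⟨ψ, hinj, hψ⟩ := exists_psi (x := x) hp (fun n => hPdvd (n + 1))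
    (fun n => hPpos (n + 1)) hPw (fun n => by
      refine hnice _ ?_ (hPdvd _) ⟨x, P, ⟨hT, hcl x hx⟩, hP, _, dvd_rfl⟩
      exact lt_of_le_of_lt (Nat.le_of_dvd (hPpos 0) (hPdvd 0)) (hP.1 (Nat.succ_pos n)))
  obtain ⟨π, hπ, hπ0, hπs, hπb⟩ := exists_phase hX hx hpp hess
  let F := Fmap p hp ψ
  let Φ : ↥X → ℤ → A := fun y => F ((π y).cast : ℤ) y.1
  have hΦ : ∀ (y : ↥X) (a : ℤ), π y = a → Φ y = F a y.1 := by
    intro y a ha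
    have h1 : (((π y).cast : ℤ) : ZMod p) = (a : ZMod p) := by
      rw [ZMod.intCast_cast, ZMod.cast_id', id, ha]
    rw [eq_comm, ZMod.intCast_eq_intCast_iff_dvd_sub] at h1
    obtain ⟨c, hc⟩ := h1
    have e : ((π y).cast : ℤ) = a + c * p := by linarith [mul_comm (p : ℤ) c]
    change F ((π y).cast : ℤ) y.1 = _
    rw [e]
    exact Fmap_period hp ψ a c y.1
  have hlift : ∀ y : ↥X, ∃ a : ℤ, π y = a := fun y =>
    ⟨(π y).cast, by rw [ZMod.intCast_cast, ZMod.cast_id', id]⟩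
  have hΦs : ∀ (y : ↥X) (k : ℤ), Φ ⟨shiftBy k y.1, hinv y.1 y.2 k⟩ = shiftBy (-k) (Φ y) := by
    intro y k
    obtain ⟨a, ha⟩ := hlift y
    rw [hΦ y a ha, hΦ _ (a + k) (by rw [hπs, ha]; push_cast; rfl)]
    exact Fmap_shift hp ψ a k y.1
  have hΦc : Continuous Φ := by
    rw [continuous_iff_continuousAt]
    intro y
    obtain ⟨a, ha⟩ := hlift y
    have h1 : ContinuousAt (fun z : ↥X => F a z.1) y :=
      ((Fmap_continuous hp ψ a).comp continuous_subtype_val).continuousAt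
    refine h1.congr ?_
    filter_upwards [hπ.eventually_eq y] with z hz
    rw [hΦ z a (by rw [hz, ha])]
  have hΦx : Φ ⟨x, hx⟩ ∈ X := by
    rw [hΦ _ 0 (by rw [hπ0]; simp)]
    change Fmap p hp ψ 0 x ∈ X
    rw [hcl x hx, mem_closure_window]
    intro N
    obtain ⟨m, hm⟩ := hψ (N + 1)
    refine ⟨shiftBy m x, ⟨m, rfl⟩, fun i hi => ?_⟩
    obtain ⟨k, t, h1, h2⟩ := Fmap_decomp hp 0 i
    have h3 := Fmap_apply hp ψ 0 x k t
    rw [← h1] at h3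
    change _ = Fmap p hp ψ 0 x i
    rw [h3, sub_zero, hm k (by omega)]
    simp only [shiftBy, blk]
    rw [h1]
    congr 1
    ring
  have hΦX : ∀ y, Φ y ∈ X := by
    intro y
    refine dense_ind (hcl x hx).subset (hinv x hx) (hclosed.preimage hΦc) (fun k => ?_) y
    change Φ _ ∈ X
    rw [hΦs ⟨x, hx⟩ k]
    exact hinv _ hΦx _
  let G : ↥X → ↥X := fun y => ⟨Φ y, hΦX y⟩
  have hGc : Continuous G := hΦc.subtype_mk hΦX
  have hπG : ∀ y, π (G y) + π y = π (G ⟨x, hx⟩) := by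
    intro y
    have hlc : IsLocallyConstant fun y => π (G y) + π y := (hπ.comp_continuous hGc).add hπ
    refine dense_ind (hcl x hx).subset (hinv x hx)
      (C := {y | π (G y) + π y = π (G ⟨x, hx⟩)}) (hlc.isClosed_fiber _) (fun k => ?_) y
    change π (G _) + π _ = _
    have e : G ⟨shiftBy k x, hinv x hx k⟩ =
        ⟨shiftBy (-k) (G ⟨x, hx⟩).1, hinv _ (G ⟨x, hx⟩).2 _⟩ := Subtype.ext (hΦs ⟨x, hx⟩ k)
    rw [e, hπs, hπs ⟨x, hx⟩ k, hπ0]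
    push_cast
    ring
  have hGinj : Function.Injective G := by
    intro y z h
    have h1 : π y = π z := by
      have a1 := hπG y
      have a2 := hπG z
      rw [h, ← a2] at a1
      exact add_left_cancel a1
    obtain ⟨a, ha⟩ := hlift y
    have h2 : Fmap p hp ψ a y.1 = Fmap p hp ψ a z.1 := by
      have := congrArg Subtype.val h
      change Φ y = Φ z at this
      rwa [hΦ y a ha, hΦ z a (by rw [← h1, ha])] at this
    have h3 : ∀ k : ℤ, blk p y.1 (k * p - a) = blk p z.1 (k * p - a) := by
      intro k
      obtain ⟨k1, e1⟩ := hπb y a ha k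
      obtain ⟨k2, e2⟩ := hπb z a (by rw [← h1, ha]) k
      rw [e1, e2]
      apply hinj
      rw [← e1, ← e2]
      funext t
      rw [← Fmap_apply hp ψ a y.1 k t, ← Fmap_apply hp ψ a z.1 k t, h2]
    apply Subtype.ext
    funext i
    have h0 := Int.emod_nonneg (i + a) (b := p) (by omega)
    have h1 := Int.emod_lt_of_pos (i + a) (b := p) (by omega)
    have h2 := Int.emod_add_mul_ediv (i + a) p
    have h4 := blk_eq.1 (h3 ((i + a) / p)) ((i + a) % p) h0 h1
    rwa [show (i + a) / p * p - a + (i + a) % p = i by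
      linarith [mul_comm (p : ℤ) ((i + a) / p)]] at h4
  have hGsurj : Function.Surjective G := by
    intro y
    refine dense_ind (hcl _ hΦx).subset (hinv _ hΦx) (C := Set.range G)
      (isCompact_range hGc).isClosed (fun k => ?_) y
    refine ⟨⟨shiftBy (-k) x, hinv x hx _⟩, Subtype.ext ?_⟩
    have := hΦs ⟨x, hx⟩ (-k)
    rw [neg_neg] at this
    exact this
  refine ⟨Continuous.homeoOfEquivCompactToT2 (f := Equiv.ofBijective G ⟨hGinj, hGsurj⟩) hGc, ?_⟩
  intro y hy hy'
  exact hΦs ⟨y, hy⟩ 1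

theorem toeplitz_residual [TopologicalSpace A] [DiscreteTopology A]
    {X : Set (ℤ → A)} (hX : IsToeplitzSubshift X) :
    {z : ↥X | IsToeplitz z.1} ∈ residual ↥X := by
  obtain ⟨x, hT, hXx⟩ := id hX
  have hx : x ∈ X := by rw [hXx]; exact subset_closure ⟨0, (shiftBy_zero x).symm⟩
  have hinv : ∀ k, shiftBy k x ∈ X := fun k => mem_shiftBy hX hx k
  have hop : ∀ (q : ℕ) (i : ℤ), 0 < q → IsOpen {z : ↥X | i ∈ PerSet z.1 q} := by
    intro q i hq
    rw [← isClosed_compl_iff]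
    have hiff : ∀ (z : ↥X) (j : ℤ), z.1 ∈ subOrb x q j →
        (i ∈ PerSet z.1 q ↔ i + j ∈ PerSet x q) := by
      intro z j hj
      have hxz : x ∈ closure (orbit z.1) := by rw [← closure_eq_of_mem hX z.2]; exact hx
      have e := skel_transfer hq hxz hj i
      constructor
      · intro h
        have h1 : Skel z.1 q i = some (z.1 i) := skel_eq_some.2 ⟨h, rfl⟩
        rw [e] at h1
        exact (skel_eq_some.1 h1).1
      · intro h
        have h1 : Skel x q (i + j) = some (x (i + j)) := skel_eq_some.2 ⟨h, rfl⟩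
        rw [← e] at h1
        exact (skel_eq_some.1 h1).1
    have : {z : ↥X | i ∈ PerSet z.1 q}ᶜ =
        ⋃ j ∈ {j : ℕ | j < q ∧ i + j ∉ PerSet x q}, Subtype.val ⁻¹' (subOrb x q (j : ℤ)) := by
      ext z
      simp only [Set.mem_compl_iff, Set.mem_preimage, Set.mem_iUnion, exists_prop]
      constructor
      · intro h
        obtain ⟨j, hj, hz⟩ := exists_subOrb (hXx ▸ z.2 : z.1 ∈ closure (orbit x)) hq
        exact ⟨j, ⟨hj, fun h' => h ((hiff z j hz).2 h')⟩, hz⟩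
      · rintro ⟨j, ⟨h1, h2⟩, h3⟩ h
        exact h2 ((hiff z j h3).1 h)
    rw [this]
    apply Set.Finite.isClosed_biUnion
    · exact (Set.finite_lt_nat q).subset fun j hj => hj.1
    · intro j _
      exact isClosed_closure.preimage continuous_subtype_val
  have heq : {z : ↥X | IsToeplitz z.1} =
      ⋂ i : ℤ, ⋃ q ∈ {q : ℕ | 1 < q}, {z : ↥X | i ∈ PerSet z.1 q} := by
    ext z
    simp only [Set.mem_iInter, Set.mem_iUnion, exists_prop]
    rfl
  rw [heq]
  refine countable_iInter_mem.2 fun i => residual_of_dense_open ?_ ?_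
  · exact isOpen_biUnion fun q hq => hop q i (lt_trans one_pos hq)
  · rw [Subtype.dense_iff]
    intro z hz
    rw [hXx] at hz
    refine closure_mono ?_ hz
    rintro w ⟨k, rfl⟩
    refine ⟨⟨_, hinv k⟩, ?_, rfl⟩
    simp only [Set.mem_iUnion, exists_prop]
    obtain ⟨q, hq, h⟩ := hT (i + k)
    refine ⟨q, hq, fun l => ?_⟩
    have := h l
    simp only [shiftBy]
    rw [← this]
    congr 1
    ring

end Backward

/-- For an aperiodic Toeplitz subshift `X`, conjugacy of `(X, S)` with
`(X, S⁻¹)` is equivalent to: every Toeplitz sequence of `X` has nice symmetries with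
respect to some scale-compatible `p` and all corresponding `q`; equivalently a
nonmeager set of points does; equivalently one Toeplitz sequence does. -/
theorem statement17 {A : Type*} [Fintype A] [TopologicalSpace A] [DiscreteTopology A]
    (X : Set (ℤ → A)) (hX : IsToeplitzSubshift X)
    (hap : ∀ x ∈ X, IsAperiodicPoint x) :
    (ConjugateBy X X shift shiftInv ↔ ∀ x ∈ X, IsToeplitz x → NiceSymAll X x) ∧
    (ConjugateBy X X shift shiftInv ↔
      ¬ IsMeagre {z : ↥X | NiceSymAll X (z : ℤ → A)}) ∧
    (ConjugateBy X X shift shiftInv ↔ ∃ x ∈ X, IsToeplitz x ∧ NiceSymAll X x) := by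
  have hres := toeplitz_residual hX
  obtain ⟨x0, hT0, hX0⟩ := id hX
  have hx0 : x0 ∈ X := by rw [hX0]; exact subset_closure ⟨0, (shiftBy_zero x0).symm⟩
  have hclosed : IsClosed X := by rw [hX0]; exact isClosed_closure
  have : CompactSpace ↥X := isCompact_iff_compactSpace.1 hclosed.isCompact
  have : Nonempty ↥X := ⟨⟨x0, hx0⟩⟩
  have h12 : ConjugateBy X X shift shiftInv → ∀ x ∈ X, IsToeplitz x → NiceSymAll X x :=
    fun h => forward hX hap h
  have h41 : (∃ x ∈ X, IsToeplitz x ∧ NiceSymAll X x) → ConjugateBy X X shift shiftInv :=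
    fun ⟨x, hx, hT, hN⟩ => backward hX hap hx hT hN
  refine ⟨⟨h12, fun h => h41 ⟨x0, hx0, hT0, h x0 hx0 hT0⟩⟩, ⟨fun h hm => ?_, fun h => ?_⟩,
    ⟨fun h => ⟨x0, hx0, hT0, h12 h x0 hx0 hT0⟩, h41⟩⟩
  · have hmem : {z : ↥X | NiceSymAll X (z : ℤ → A)} ∈ residual ↥X :=
      Filter.mem_of_superset hres fun z hz => h12 h z.1 z.2 hz
    have h2 := Filter.inter_mem hmem hm
    obtain ⟨z, hz⟩ := (dense_of_mem_residual h2).nonempty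
    exact hz.2 hz.1
  · by_contra hc
    apply h
    refine Filter.mem_of_superset hres fun z hz hz' => ?_
    exact hc (h41 ⟨z.1, z.2, hz, hz'⟩)


end ToeplitzFR
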